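/- arXiv:2108.07637 — 3 statements merged into one kernel-verified Lean document; each statement's English description precedes it below -/
import Mathlib

section
/- For every n ≥ 1, the poset ASM_n of n×n alternating sign matrices under the partial-sum order is a lattice: for A, B ∈ ASM_n there is a unique alternating sign matrix whose partial-sum matrix is the entrywise minimum of C(A) and C(B), and it is the least upper bound A ∨ B; likewise there is a unique alternating sign matrix whose partial-sum matrix is the entrywise maximum of C(A) and C(B), and it is the greatest lower bound A ∧ B. -/
namespace ASMPaper

/-- The nonzero entries of a vector (a row or a column of a matrix) alternate in sign:
any two nonzero entries with only zero entries strictly between them have opposite values. -/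
def Alternating {n : ℕ} (v : Fin n → ℤ) : Prop :=
  ∀ j₁ j₂ : Fin n, j₁ < j₂ → v j₁ ≠ 0 → v j₂ ≠ 0 →
    (∀ j, j₁ < j → j < j₂ → v j = 0) → v j₂ = - v j₁

/-- `A` is an alternating sign matrix: entries in `{-1,0,1}`, all row and column sums
equal to `1`, and the nonzero entries in each row and column alternate in sign. -/
def IsASM {n : ℕ} (A : Matrix (Fin n) (Fin n) ℤ) : Prop :=
  (∀ i j, A i j = -1 ∨ A i j = 0 ∨ A i j = 1) ∧
  (∀ i, ∑ j, A i j = 1) ∧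
  (∀ j, ∑ i, A i j = 1) ∧
  (∀ i, Alternating (fun j => A i j)) ∧
  (∀ j, Alternating (fun i => A i j))

/-- The partial sum `C(A)_{kl} = ∑_{i ≤ k, j ≤ l} A_{ij}`. -/
def Csum {n : ℕ} (A : Matrix (Fin n) (Fin n) ℤ) (k l : Fin n) : ℤ :=
  ∑ i ∈ Finset.Iic k, ∑ j ∈ Finset.Iic l, A i j

/-- The partial-sum (Bruhat) order on alternating sign matrices:
`A ≤ B` iff all partial sums of `A` are at least those of `B`. -/
def asmLe {n : ℕ} (A B : Matrix (Fin n) (Fin n) ℤ) : Prop :=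
  ∀ k l, Csum B k l ≤ Csum A k l

end ASMPaper

namespace ASMPaper

/-- The sum of the first `m` entries of `v`. -/
def prefixSum {n : ℕ} (v : Fin n → ℤ) (m : ℕ) : ℤ :=
  ∑ j ∈ Finset.univ.filter (fun j : Fin n => (j : ℕ) < m), v j

section PrefixSum

variable {n : ℕ}

theorem prefixSum_zero (v : Fin n → ℤ) : prefixSum v 0 = 0 := by
  simp [prefixSum]

theorem prefixSum_succ (v : Fin n → ℤ) (j : Fin n) :
    prefixSum v (j + 1) = prefixSum v j + v j := by
  have h : Finset.univ.filter (fun i : Fin n => (i : ℕ) < j + 1) =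
      insert j (Finset.univ.filter (fun i : Fin n => (i : ℕ) < j)) := by
    ext i
    simp only [Finset.mem_filter, Finset.mem_univ, true_and, Finset.mem_insert, Fin.ext_iff]
    omega
  rw [prefixSum, h, Finset.sum_insert (by simp), add_comm, prefixSum]

theorem prefixSum_self (v : Fin n → ℤ) : prefixSum v n = ∑ j, v j := by
  simp [prefixSum]

theorem sum_Iic_eq_prefixSum (v : Fin n → ℤ) (k : Fin n) :
    ∑ j ∈ Finset.Iic k, v j = prefixSum v (k + 1) := by
  refine Finset.sum_congr ?_ fun _ _ => rfl
  ext i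
  simp only [Finset.mem_Iic, Finset.mem_filter, Finset.mem_univ, true_and, Fin.le_def]
  omega

theorem prefixSum_sub (f : ℕ → ℤ) {m : ℕ} (hm : m ≤ n) :
    prefixSum (fun j : Fin n => f (j + 1) - f j) m = f m - f 0 := by
  induction m with
  | zero => simp [prefixSum_zero]
  | succ m ih =>
    have := prefixSum_succ (fun j : Fin n => f (j + 1) - f j) ⟨m, hm⟩
    simp only at this
    rw [this, ih (by omega)]
    ring

/-- The prefix sums of a vector with alternating entries `±1` and `0` all lie in `{0, e}`,
where `e` is the first nonzero entry. -/
theorem Alternating.exists_prefixSum_eq {v : Fin n → ℤ} (hv : Alternating v)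
    (h : ∀ j, v j = -1 ∨ v j = 0 ∨ v j = 1) {m : ℕ} (hm : m ≤ n) :
    ∃ e : ℤ, (e = 1 ∨ e = -1) ∧ (∀ m' ≤ m, prefixSum v m' = 0 ∨ prefixSum v m' = e) ∧
      (((∀ j : Fin n, (j : ℕ) < m → v j = 0) ∧ ∀ m' ≤ m, prefixSum v m' = 0) ∨
        ∃ j : Fin n, (j : ℕ) < m ∧ (∀ i : Fin n, j < i → (i : ℕ) < m → v i = 0) ∧
          (v j = e ∧ prefixSum v m = e ∨ v j = -e ∧ prefixSum v m = 0)) := by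
  induction m with
  | zero => exact ⟨1, by simp [prefixSum_zero]⟩
  | succ m ih =>
    obtain ⟨e, he, hS, hlast⟩ := ih (by omega)
    set q : Fin n := ⟨m, hm⟩ with hq
    have hsucc : prefixSum v (m + 1) = prefixSum v m + v q := prefixSum_succ v q
    have hcases : ∀ i : Fin n, (i : ℕ) < m + 1 → (i : ℕ) < m ∨ i = q := fun i hi => by
      simp only [hq, Fin.ext_iff]; omega
    have hle : ∀ m' ≤ m + 1, m' ≤ m ∨ m' = m + 1 := fun m' h' => by omega
    by_cases h0 : v q = 0
    · rw [h0, add_zero] at hsucc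
      refine ⟨e, he, fun m' h' => ?_, ?_⟩
      · rcases hle m' h' with h' | rfl
        · exact hS m' h'
        · rw [hsucc]; exact hS m le_rfl
      · rcases hlast with ⟨hz, hz'⟩ | ⟨j, hj, hz, hval⟩
        · refine .inl ⟨fun i hi => ?_, fun m' h' => ?_⟩
          · rcases hcases i hi with hi | rfl
            exacts [hz i hi, h0]
          · rcases hle m' h' with h' | rfl
            · exact hz' m' h'
            · rw [hsucc]; exact hz' m le_rfl
        · refine .inr ⟨j, by omega, fun i hji hi => ?_, by rwa [hsucc]⟩
          rcases hcases i hi with hi | rfl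
          exacts [hz i hji hi, h0]
    · have hnone : ∀ i : Fin n, q < i → (i : ℕ) < m + 1 → v i = 0 := fun i hi hi' => by
        simp only [hq, Fin.lt_def] at hi; omega
      rcases hlast with ⟨hz, hz'⟩ | ⟨j, hj, hz, hval⟩
      · have hsq : prefixSum v (m + 1) = v q := by rw [hsucc, hz' m le_rfl, zero_add]
        refine ⟨v q, ?_, fun m' h' => ?_, .inr ⟨q, by simp [hq], hnone, .inl ⟨rfl, hsq⟩⟩⟩
        · rcases h q with h | h | h <;> simp_all
        · rcases hle m' h' with h' | rfl
          · exact .inl (hz' m' h')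
          · exact .inr hsq
      · have halt : v q = - v j := by
          refine hv j q (by simpa [hq, Fin.lt_def] using hj) ?_ h0 fun i hji hi => hz i hji hi
          omega
        refine ⟨e, he, fun m' h' => ?_, .inr ⟨q, by simp [hq], hnone, by omega⟩⟩
        rcases hle m' h' with h' | rfl
        · exact hS m' h'
        · omega

theorem Alternating.prefixSum_mem {v : Fin n → ℤ} (hv : Alternating v)
    (h : ∀ j, v j = -1 ∨ v j = 0 ∨ v j = 1) (hsum : ∑ j, v j = 1) {m : ℕ} (hm : m ≤ n) :
    prefixSum v m = 0 ∨ prefixSum v m = 1 := by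
  obtain ⟨e, he, hS, -⟩ := hv.exists_prefixSum_eq h le_rfl
  have h1 := hS n le_rfl
  rw [prefixSum_self, hsum] at h1
  have h2 := hS m hm
  omega

theorem mem_of_prefixSum_mem {v : Fin n → ℤ}
    (h : ∀ m ≤ n, prefixSum v m = 0 ∨ prefixSum v m = 1) (j : Fin n) :
    v j = -1 ∨ v j = 0 ∨ v j = 1 := by
  have := prefixSum_succ v j
  have := h j (by omega)
  have := h (j + 1) (by omega)
  omega

theorem alternating_of_prefixSum_mem {v : Fin n → ℤ}
    (h : ∀ m ≤ n, prefixSum v m = 0 ∨ prefixSum v m = 1) : Alternating v := by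
  intro j₁ j₂ hlt h₁ h₂ hz
  have hconst : ∀ m, (j₁ : ℕ) + 1 ≤ m → m ≤ j₂ → prefixSum v m = prefixSum v (j₁ + 1) := by
    intro m hm
    induction m, hm using Nat.le_induction with
    | base => exact fun _ => rfl
    | succ m hm ih =>
      intro hm'
      have hs : prefixSum v (m + 1) = prefixSum v m + v ⟨m, by omega⟩ :=
        prefixSum_succ v ⟨m, by omega⟩
      rw [hs, ih (by omega), hz _ (Fin.lt_def.2 (by simp; omega)) (Fin.lt_def.2 (by simp; omega)),
        add_zero]
  have := hconst j₂ hlt le_rfl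
  have := prefixSum_succ v j₁
  have := prefixSum_succ v j₂
  have := h j₁ (by omega)
  have := h (j₁ + 1) (by omega)
  have := h j₂ (by omega)
  have := h (j₂ + 1) (by omega)
  omega

end PrefixSum

/-- The sum of the entries of `A` in its first `k` rows and first `l` columns. -/
def cornerSum {n : ℕ} (A : Matrix (Fin n) (Fin n) ℤ) (k l : ℕ) : ℤ :=
  prefixSum (fun i => prefixSum (A i) l) k

/-- The characterization of the corner sums of an `n × n` alternating sign matrix. -/
structure IsCornerSum (n : ℕ) (P : ℕ → ℕ → ℤ) : Prop where
  zero_left : ∀ l ≤ n, P 0 l = 0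
  zero_right : ∀ k ≤ n, P k 0 = 0
  last_left : ∀ l ≤ n, P n l = l
  last_right : ∀ k ≤ n, P k n = k
  step_left : ∀ k < n, ∀ l ≤ n, P (k + 1) l - P k l = 0 ∨ P (k + 1) l - P k l = 1
  step_right : ∀ k ≤ n, ∀ l < n, P k (l + 1) - P k l = 0 ∨ P k (l + 1) - P k l = 1

section CornerSum

variable {n : ℕ} {A B : Matrix (Fin n) (Fin n) ℤ}

theorem Csum_eq_cornerSum (A : Matrix (Fin n) (Fin n) ℤ) (k l : Fin n) :
    Csum A k l = cornerSum A (k + 1) (l + 1) := by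
  simp only [Csum, cornerSum, sum_Iic_eq_prefixSum]

theorem cornerSum_zero_left (A : Matrix (Fin n) (Fin n) ℤ) (l : ℕ) : cornerSum A 0 l = 0 :=
  prefixSum_zero _

theorem cornerSum_transpose (A : Matrix (Fin n) (Fin n) ℤ) (k l : ℕ) :
    cornerSum A.transpose k l = cornerSum A l k := by
  simp only [cornerSum, prefixSum]
  exact Finset.sum_comm

theorem cornerSum_zero_right (A : Matrix (Fin n) (Fin n) ℤ) (k : ℕ) : cornerSum A k 0 = 0 := by
  rw [← cornerSum_transpose, cornerSum_zero_left]

theorem cornerSum_succ_left (A : Matrix (Fin n) (Fin n) ℤ) (i : Fin n) (l : ℕ) :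
    cornerSum A (i + 1) l = cornerSum A i l + prefixSum (A i) l :=
  prefixSum_succ _ i

theorem eq_of_Csum_eq (h : ∀ k l, Csum A k l = Csum B k l) : A = B := by
  have hP : ∀ k ≤ n, ∀ l ≤ n, cornerSum A k l = cornerSum B k l := by
    rintro (_ | k) hk (_ | l) hl
    · simp only [cornerSum_zero_left]
    · simp only [cornerSum_zero_left]
    · simp only [cornerSum_zero_right]
    · have := h ⟨k, hk⟩ ⟨l, hl⟩
      rwa [Csum_eq_cornerSum, Csum_eq_cornerSum] at this
  ext i j
  have hrow : ∀ l ≤ n, prefixSum (A i) l = prefixSum (B i) l := fun l hl => by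
    have h₁ := cornerSum_succ_left A i l
    have h₂ := cornerSum_succ_left B i l
    rw [hP (i + 1) (by omega) l hl, hP i (by omega) l hl] at h₁
    omega
  have h₁ := prefixSum_succ (A i) j
  have h₂ := prefixSum_succ (B i) j
  rw [hrow (j + 1) (by omega), hrow j (by omega)] at h₁
  omega

theorem IsASM.transpose (hA : IsASM A) : IsASM A.transpose :=
  ⟨fun i j => hA.1 j i, hA.2.2.1, hA.2.1, hA.2.2.2.2, hA.2.2.2.1⟩

theorem IsASM.cornerSum_step_left (hA : IsASM A) {k l : ℕ} (hk : k < n) (hl : l ≤ n) :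
    cornerSum A (k + 1) l - cornerSum A k l = 0 ∨
      cornerSum A (k + 1) l - cornerSum A k l = 1 := by
  have h := cornerSum_succ_left A ⟨k, hk⟩ l
  simp only at h
  rw [h, add_sub_cancel_left]
  exact Alternating.prefixSum_mem (hA.2.2.2.1 _) (hA.1 _) (hA.2.1 _) hl

theorem IsASM.cornerSum_last_right (hA : IsASM A) {k : ℕ} (hk : k ≤ n) :
    cornerSum A k n = k := by
  induction k with
  | zero => exact cornerSum_zero_left A n
  | succ k ih =>
    have h := cornerSum_succ_left A ⟨k, hk⟩ n
    simp only at h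
    rw [h, ih (by omega), prefixSum_self, hA.2.1, Nat.cast_succ]

theorem IsASM.isCornerSum (hA : IsASM A) : IsCornerSum n (cornerSum A) where
  zero_left l _ := cornerSum_zero_left A l
  zero_right k _ := cornerSum_zero_right A k
  last_left l hl := by
    rw [← cornerSum_transpose, hA.transpose.cornerSum_last_right hl]
  last_right k hk := hA.cornerSum_last_right hk
  step_left k hk l hl := hA.cornerSum_step_left hk hl
  step_right k hk l hl := by
    simpa only [cornerSum_transpose] using hA.transpose.cornerSum_step_left hl hk

end CornerSum

namespace IsCornerSum

variable {n : ℕ} {P Q : ℕ → ℕ → ℤ}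

protected theorem min (hP : IsCornerSum n P) (hQ : IsCornerSum n Q) :
    IsCornerSum n fun k l => min (P k l) (Q k l) where
  zero_left l hl := by rw [hP.zero_left l hl, hQ.zero_left l hl, min_self]
  zero_right k hk := by rw [hP.zero_right k hk, hQ.zero_right k hk, min_self]
  last_left l hl := by rw [hP.last_left l hl, hQ.last_left l hl, min_self]
  last_right k hk := by rw [hP.last_right k hk, hQ.last_right k hk, min_self]
  step_left k hk l hl := by
    have := hP.step_left k hk l hl
    have := hQ.step_left k hk l hl
    omega
  step_right k hk l hl := by
    have := hP.step_right k hk l hl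
    have := hQ.step_right k hk l hl
    omega

protected theorem max (hP : IsCornerSum n P) (hQ : IsCornerSum n Q) :
    IsCornerSum n fun k l => max (P k l) (Q k l) where
  zero_left l hl := by rw [hP.zero_left l hl, hQ.zero_left l hl, max_self]
  zero_right k hk := by rw [hP.zero_right k hk, hQ.zero_right k hk, max_self]
  last_left l hl := by rw [hP.last_left l hl, hQ.last_left l hl, max_self]
  last_right k hk := by rw [hP.last_right k hk, hQ.last_right k hk, max_self]
  step_left k hk l hl := by
    have := hP.step_left k hk l hl
    have := hQ.step_left k hk l hl
    omega
  step_right k hk l hl := by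
    have := hP.step_right k hk l hl
    have := hQ.step_right k hk l hl
    omega

/-- Every function satisfying the corner-sum conditions comes from an alternating sign matrix. -/
theorem exists_isASM (hP : IsCornerSum n P) :
    ∃ J : Matrix (Fin n) (Fin n) ℤ, IsASM J ∧
      ∀ k l : Fin n, Csum J k l = P (k + 1) (l + 1) := by
  let J : Matrix (Fin n) (Fin n) ℤ := fun i j =>
    (P (i + 1) (j + 1) - P i (j + 1)) - (P (i + 1) j - P i j)
  have hrow : ∀ i : Fin n, ∀ m ≤ n,
      prefixSum (fun j => J i j) m = P (i + 1) m - P i m := fun i m hm => by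
    rw [prefixSum_sub (fun l => P (i + 1) l - P i l) hm, hP.zero_right _ (by omega),
      hP.zero_right _ (by omega), sub_zero, sub_zero]
  have hcol : ∀ j : Fin n, ∀ m ≤ n,
      prefixSum (fun i => J i j) m = P m (j + 1) - P m j := fun j m hm => by
    have hJ : (fun i => J i j) = fun i : Fin n =>
        (P (i + 1) (j + 1) - P (i + 1) j) - (P i (j + 1) - P i j) := by
      funext i; simp only [J]; ring
    rw [hJ, prefixSum_sub (fun k => P k (j + 1) - P k j) hm, hP.zero_left _ (by omega),
      hP.zero_left _ (by omega), sub_zero, sub_zero]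
  have hrow' : ∀ i : Fin n, ∀ m ≤ n,
      prefixSum (fun j => J i j) m = 0 ∨ prefixSum (fun j => J i j) m = 1 := fun i m hm => by
    rw [hrow i m hm]; exact hP.step_left i i.2 m hm
  have hcol' : ∀ j : Fin n, ∀ m ≤ n,
      prefixSum (fun i => J i j) m = 0 ∨ prefixSum (fun i => J i j) m = 1 := fun j m hm => by
    rw [hcol j m hm]; exact hP.step_right m hm j j.2
  refine ⟨J, ⟨fun i => mem_of_prefixSum_mem (hrow' i), fun i => ?_, fun j => ?_,
    fun i => alternating_of_prefixSum_mem (hrow' i),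
    fun j => alternating_of_prefixSum_mem (hcol' j)⟩, fun k l => ?_⟩
  · rw [← prefixSum_self, hrow i n le_rfl, hP.last_right _ (by omega), hP.last_right _ (by omega)]
    push_cast; ring
  · rw [← prefixSum_self, hcol j n le_rfl, hP.last_left _ (by omega), hP.last_left _ (by omega)]
    push_cast; ring
  · have h : (fun i => prefixSum (J i) (l + 1)) =
        fun i : Fin n => P (i + 1) (l + 1) - P i (l + 1) :=
      funext fun i => hrow i (l + 1) (by omega)
    rw [Csum_eq_cornerSum, cornerSum, h, prefixSum_sub (fun k => P k (l + 1)) (by omega),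
      hP.zero_left _ (by omega), sub_zero]

theorem existsUnique_isASM (hP : IsCornerSum n P) :
    ∃! J : Matrix (Fin n) (Fin n) ℤ, IsASM J ∧
      ∀ k l : Fin n, Csum J k l = P (k + 1) (l + 1) := by
  obtain ⟨J, hJ, hJP⟩ := hP.exists_isASM
  exact ⟨J, ⟨hJ, hJP⟩, fun K hK => eq_of_Csum_eq fun k l => (hK.2 k l).trans (hJP k l).symm⟩

end IsCornerSum

end ASMPaper

open ASMPaper in
/-- The poset `ASM_n` is a lattice: for alternating sign matrices `A, B` there is a unique
alternating sign matrix whose partial-sum matrix is the entrywise minimum of `C(A)` and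
`C(B)`, and it is the least upper bound `A ∨ B`; likewise there is a unique alternating
sign matrix whose partial-sum matrix is the entrywise maximum, and it is the greatest
lower bound `A ∧ B`. -/
theorem asm_lattice (n : ℕ) (hn : 1 ≤ n) (A B : Matrix (Fin n) (Fin n) ℤ)
    (hA : IsASM A) (hB : IsASM B) :
    (∃! J : Matrix (Fin n) (Fin n) ℤ, IsASM J ∧
      ∀ k l, Csum J k l = min (Csum A k l) (Csum B k l)) ∧
    (∀ J : Matrix (Fin n) (Fin n) ℤ, IsASM J →
      (∀ k l, Csum J k l = min (Csum A k l) (Csum B k l)) →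
      asmLe A J ∧ asmLe B J ∧
        ∀ D : Matrix (Fin n) (Fin n) ℤ, IsASM D → asmLe A D → asmLe B D → asmLe J D) ∧
    (∃! M : Matrix (Fin n) (Fin n) ℤ, IsASM M ∧
      ∀ k l, Csum M k l = max (Csum A k l) (Csum B k l)) ∧
    (∀ M : Matrix (Fin n) (Fin n) ℤ, IsASM M →
      (∀ k l, Csum M k l = max (Csum A k l) (Csum B k l)) →
      asmLe M A ∧ asmLe M B ∧
        ∀ D : Matrix (Fin n) (Fin n) ℤ, IsASM D → asmLe D A → asmLe D B → asmLe D M) := by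
  refine ⟨?_, fun J _ hJ => ⟨fun k l => ?_, fun k l => ?_, fun D _ hAD hBD k l => ?_⟩,
    ?_, fun M _ hM => ⟨fun k l => ?_, fun k l => ?_, fun D _ hDA hDB k l => ?_⟩⟩
  · simpa only [Csum_eq_cornerSum] using (hA.isCornerSum.min hB.isCornerSum).existsUnique_isASM
  · rw [hJ]; exact min_le_left _ _
  · rw [hJ]; exact min_le_right _ _
  · rw [hJ]; exact le_min (hAD k l) (hBD k l)
  · simpa only [Csum_eq_cornerSum] using (hA.isCornerSum.max hB.isCornerSum).existsUnique_isASM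
  · rw [hM]; exact le_max_left _ _
  · rw [hM]; exact le_max_right _ _
  · rw [hM]; exact max_le (hDA k l) (hDB k l)
end

section
/- For permutations x, y of {1,…,n}, the following are equivalent: (1) the permutation matrices satisfy Σ_{i≤k, j≤l} [x]_{ij} ≥ Σ_{i≤k, j≤l} [y]_{ij} for all 1 ≤ k,l ≤ n; (2) x ≤ y in the Bruhat order, i.e., the pair (x,y) lies in the reflexive-transitive closure of the relation relating z to z·t whenever t is a transposition and inv(z) < inv(z·t), where inv(z) denotes the number of inversions of z (pairs i < j with z(i) > z(j)). In particular, the map sending a permutation to its permutation matrix is an order embedding of the Bruhat order on the symmetric group S_n into ASM_n. -/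
namespace ASMPaper

/-- The permutation matrix of `x`: `[x]_{ij} = 1` if `x j = i` and `0` otherwise. -/
def permMat {n : ℕ} (x : Equiv.Perm (Fin n)) : Matrix (Fin n) (Fin n) ℤ :=
  Matrix.of fun i j => if x j = i then 1 else 0

/-- The number of inversions of a permutation: pairs `i < j` with `x i > x j`. -/
def invCount {n : ℕ} (x : Equiv.Perm (Fin n)) : ℕ :=
  (Finset.univ.filter (fun p : Fin n × Fin n => p.1 < p.2 ∧ x p.2 < x p.1)).card

/-- One step of the Bruhat order: `z` is related to `z * t` for a transposition `t`
increasing the number of inversions. -/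
def bruhatStep {n : ℕ} (z w : Equiv.Perm (Fin n)) : Prop :=
  ∃ t : Equiv.Perm (Fin n), t.IsSwap ∧ w = z * t ∧ invCount z < invCount (z * t)

end ASMPaper

namespace ASMPaper

lemma csum_permMat {n : ℕ} (x : Equiv.Perm (Fin n)) (k l : Fin n) :
    Csum (permMat x) k l = ∑ j, if j ≤ l ∧ x j ≤ k then (1 : ℤ) else 0 := by
  simp only [Csum, permMat, Matrix.of_apply]
  rw [Finset.sum_comm]
  simp only [Finset.sum_ite_eq, Finset.mem_Iic]
  rw [← Finset.sum_filter, ← Finset.sum_filter, Finset.sum_const, Finset.sum_const]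
  congr 2
  ext j
  simp

lemma permMat_injective {n : ℕ} : Function.Injective (permMat (n := n)) := by
  intro x y h
  ext j : 1
  have h' := congrFun (congrFun h (x j)) j
  by_contra hne
  simp [permMat, Ne.symm hne] at h'

lemma csum_permMat_mul_swap {n : ℕ} (z : Equiv.Perm (Fin n)) {a b : Fin n} (hab : a < b)
    (hz : z a < z b) (k l : Fin n) :
    Csum (permMat (z * Equiv.swap a b)) k l =
      Csum (permMat z) k l - if a ≤ l ∧ l < b ∧ z a ≤ k ∧ k < z b then 1 else 0 := by
  rw [csum_permMat, csum_permMat, eq_sub_iff_add_eq', ← eq_sub_iff_add_eq,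
    ← Finset.sum_sub_distrib, Fintype.sum_eq_add a b hab.ne]
  · simp only [Equiv.Perm.mul_apply, Equiv.swap_apply_left, Equiv.swap_apply_right]
    split_ifs <;> first | rfl | omega
  · rintro j ⟨hja, hjb⟩
    simp [Equiv.swap_apply_of_ne_of_ne hja hjb]

lemma invCount_lt_mul_swap {n : ℕ} (z : Equiv.Perm (Fin n)) {a b : Fin n} (hab : a < b)
    (hz : z a < z b) : invCount z < invCount (z * Equiv.swap a b) := by
  set t := Equiv.swap a b
  have htt : ∀ i, t (t i) = i := fun i => Equiv.swap_apply_self a b i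
  let f : Fin n × Fin n → Fin n × Fin n := fun p => if t p.1 < t p.2 then (t p.1, t p.2) else p
  have hta : t a = b := Equiv.swap_apply_left a b
  have htb : t b = a := Equiv.swap_apply_right a b
  have hto : ∀ i, i ≠ a → i ≠ b → t i = i := fun i => Equiv.swap_apply_of_ne_of_ne
  unfold invCount
  rw [← Finset.card_image_of_injOn (f := f)]
  · apply Finset.card_lt_card
    rw [Finset.ssubset_iff_of_subset]
    · refine ⟨(a, b), Finset.mem_filter.mpr ⟨Finset.mem_univ _, hab, by simpa [hta, htb] using hz⟩, ?_⟩
      simp only [Finset.mem_image, Finset.mem_filter, Finset.mem_univ, true_and, Prod.exists,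
        not_exists, not_and]
      rintro i j ⟨hij, hji⟩ hf
      simp only [f] at hf
      split_ifs at hf with h
      · rw [Prod.mk.injEq] at hf
        have h1 := htt i
        have h2 := htt j
        rw [hf.1, hta] at h1
        rw [hf.2, htb] at h2
        omega
      · rw [Prod.mk.injEq] at hf
        rw [hf.1, hf.2] at hji
        omega
    · intro q hq
      simp only [Finset.mem_image, Finset.mem_filter, Finset.mem_univ, true_and, Prod.exists] at hq
      obtain ⟨i, j, ⟨hij, hji⟩, rfl⟩ := hq
      refine Finset.mem_filter.mpr ⟨Finset.mem_univ _, ?_⟩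
      simp only [f, Equiv.Perm.mul_apply]
      split_ifs with h
      · simp only [htt]
        exact ⟨h, hji⟩
      · refine ⟨hij, ?_⟩
        dsimp only at h ⊢
        by_cases hia : i = a
        · subst hia
          by_cases hjb : j = b
          · subst hjb; omega
          · rw [hta, hto j hij.ne' hjb]; omega
        · by_cases hib : i = b
          · subst hib
            rw [htb, hto j (by omega) (by omega)] at h; omega
          · by_cases hjb : j = b
            · subst hjb; rw [htb, hto i hia hib]; omega
            · by_cases hja : j = a
              · subst hja; rw [hta, hto i hia hib] at h; omega
              · rw [hto i hia hib, hto j hja hjb] at h; omega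
  · rintro ⟨i, j⟩ hp ⟨i', j'⟩ hq hf
    simp only [Finset.coe_filter, Finset.mem_univ, true_and, Set.mem_ofPred_eq] at hp hq
    simp only [f] at hf
    split_ifs at hf with h h' h'
    · simpa using hf
    · simp only [Prod.mk.injEq] at hf
      rw [← hf.1, ← hf.2, htt, htt] at h'
      exact absurd hp.1 h'
    · simp only [Prod.mk.injEq] at hf
      rw [hf.1, hf.2, htt, htt] at h
      exact absurd hq.1 h
    · exact hf

lemma csum_le_of_bruhatStep {n : ℕ} {z w : Equiv.Perm (Fin n)} (h : bruhatStep z w)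
    (k l : Fin n) : Csum (permMat w) k l ≤ Csum (permMat z) k l := by
  obtain ⟨t, ⟨a, b, hne, rfl⟩, rfl, hinv⟩ := h
  wlog hab : a < b generalizing a b
  · rw [Equiv.swap_comm] at hinv ⊢
    exact this b a hne.symm hinv (lt_of_le_of_ne (not_lt.mp hab) hne.symm)
  have hz : z a < z b := by
    by_contra hcon
    have hlt := invCount_lt_mul_swap (z * Equiv.swap a b) hab
      (by simpa using lt_of_le_of_ne (not_lt.mp hcon) (z.injective.ne hne.symm))
    rw [mul_assoc, Equiv.swap_mul_self, mul_one] at hlt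
    omega
  rw [csum_permMat_mul_swap z hab hz]
  split_ifs <;> omega

/-- If `x ≠ y` and the partial sums of `x` dominate those of `y`, then `x` can be moved one step up
in the Bruhat order while still dominating `y`. -/
lemma exists_bruhatStep_of_csum_le {n : ℕ} {x y : Equiv.Perm (Fin n)} (hne : x ≠ y)
    (h : ∀ k l, Csum (permMat y) k l ≤ Csum (permMat x) k l) :
    ∃ w, bruhatStep x w ∧ invCount x < invCount w ∧
      ∀ k l, Csum (permMat y) k l ≤ Csum (permMat w) k l := by
  obtain ⟨a, ha, hmin⟩ : ∃ a, x a ≠ y a ∧ ∀ j < a, x j = y j := by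
    have hex : ∃ a, x a ≠ y a := by
      by_contra! hcon
      exact hne (Equiv.ext hcon)
    obtain ⟨a, ha, hm⟩ := WellFounded.has_min (wellFounded_lt (α := Fin n)) {a | x a ≠ y a} hex
    exact ⟨a, ha, fun j hj => by_contra fun hc => hm j hc hj⟩
  have hsum : ∑ j, (if j = a then (1 : ℤ) else 0) = 1 := by simp
  have hlt : x a < y a := by
    by_contra hcon
    have h1 := h (y a) a
    rw [csum_permMat, csum_permMat] at h1
    have h2 : ∑ j, ((if j ≤ a ∧ x j ≤ y a then (1 : ℤ) else 0) + if j = a then 1 else 0) ≤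
        ∑ j, if j ≤ a ∧ y j ≤ y a then (1 : ℤ) else 0 := by
      apply Finset.sum_le_sum
      intro j _
      rcases lt_trichotomy j a with hj | rfl | hj
      · simp [hmin j hj, hj.ne]
      · have : ¬ x j ≤ y j := by omega
        simp [this]
      · simp [hj.ne', not_le.mpr hj]
    rw [Finset.sum_add_distrib, hsum] at h2
    omega
  obtain ⟨b, ⟨hab, hxb, hby⟩, hbmin⟩ : ∃ b, (a < b ∧ x a < x b ∧ x b ≤ y a) ∧
      ∀ j < b, ¬ (a < j ∧ x a < x j ∧ x j ≤ y a) := by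
    have hex : ∃ b, a < b ∧ x a < x b ∧ x b ≤ y a := by
      refine ⟨x.symm (y a), ?_, by simpa using hlt, by simp⟩
      rcases lt_trichotomy a (x.symm (y a)) with hj | hj | hj
      · exact hj
      · exact absurd ((Equiv.eq_symm_apply x).mp hj) ha
      · have h1 := hmin _ hj
        rw [Equiv.apply_symm_apply] at h1
        exact absurd (y.injective h1) hj.ne'
    obtain ⟨b, hb, hm⟩ := WellFounded.has_min (wellFounded_lt (α := Fin n))
      {b | a < b ∧ x a < x b ∧ x b ≤ y a} hex
    exact ⟨b, hb, fun j hj hc => hm j hc hj⟩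
  have hinv := invCount_lt_mul_swap x hab hxb
  refine ⟨_, ⟨_, ⟨a, b, hab.ne, rfl⟩, rfl, hinv⟩, hinv, fun k l => ?_⟩
  rw [csum_permMat_mul_swap x hab hxb]
  split_ifs with hkl
  · obtain ⟨hal, hlb, hak, hkb⟩ := hkl
    have h1 := h (y a) l
    rw [csum_permMat, csum_permMat] at h1 ⊢
    have h2 : ∑ j, ((if j ≤ l ∧ x j ≤ y a then (1 : ℤ) else 0) +
          (if j ≤ l ∧ y j ≤ k then 1 else 0) + if j = a then 1 else 0) ≤
        ∑ j, ((if j ≤ l ∧ y j ≤ y a then (1 : ℤ) else 0) + if j ≤ l ∧ x j ≤ k then 1 else 0) := by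
      apply Finset.sum_le_sum
      intro j _
      rcases lt_trichotomy j a with hj | rfl | hj
      · simp [hmin j hj, hj.ne]
      · have : ¬ y j ≤ k := by omega
        simp [this, hal, hak, hlt.le]
      · have := hbmin j
        split_ifs <;> omega
    simp only [Finset.sum_add_distrib, hsum] at h2
    omega
  · simpa using h k l

lemma reflTransGen_bruhatStep_of_csum_le {n : ℕ} (x y : Equiv.Perm (Fin n))
    (h : ∀ k l, Csum (permMat y) k l ≤ Csum (permMat x) k l) :
    Relation.ReflTransGen bruhatStep x y := by
  by_cases hne : x = y
  · rw [hne]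
  · obtain ⟨w, hstep, hinv, hw⟩ := exists_bruhatStep_of_csum_le hne h
    have hbound : invCount w ≤ Fintype.card (Fin n × Fin n) := Finset.card_le_univ _
    exact .head hstep (reflTransGen_bruhatStep_of_csum_le w y hw)
termination_by Fintype.card (Fin n × Fin n) - invCount x
decreasing_by omega

end ASMPaper

open ASMPaper in
/-- For permutations `x, y` of `{1, …, n}`, the entrywise comparison of partial sums of
the permutation matrices `[x]` and `[y]` is equivalent to `x ≤ y` in the Bruhat order
(the reflexive-transitive closure of multiplying by transpositions that increase the
number of inversions). In particular, `x ↦ [x]` is an order embedding of the Bruhat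
order on `S_n` into `ASM_n`. -/
theorem permMat_partialSum_iff_bruhat (n : ℕ) :
    (∀ x y : Equiv.Perm (Fin n),
      (∀ k l, Csum (permMat y) k l ≤ Csum (permMat x) k l) ↔
        Relation.ReflTransGen bruhatStep x y) ∧
    Function.Injective (permMat (n := n)) := by
  refine ⟨fun x y => ⟨reflTransGen_bruhatStep_of_csum_le x y, fun h k l => ?_⟩, permMat_injective⟩
  induction h with
  | refl => exact le_rfl
  | tail _ hstep ih => exact (csum_le_of_bruhatStep hstep k l).trans ih
end

section
/- For every n ≥ 2, the poset of bigrassmannian permutations of {1,…,n} under the Bruhat order is isomorphic, as a poset, to the tetrahedral poset Tetr_n. -/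
namespace ASMPaper

/-- The Bruhat order on permutations, via entrywise comparison of partial sums of
permutation matrices. -/
def bruhatLe {n : ℕ} (x y : Equiv.Perm (Fin n)) : Prop :=
  ∀ k l, Csum (permMat y) k l ≤ Csum (permMat x) k l

/-- The set of descents of a permutation `w` of `Fin n`: 0-indexed positions `i` with
`i + 1 < n` and `w (i+1) < w i`. -/
def descents {n : ℕ} (w : Equiv.Perm (Fin n)) : Finset ℕ :=
  (Finset.range (n - 1)).filter
    (fun i => ∀ h : i + 1 < n, w ⟨i + 1, h⟩ < w ⟨i, Nat.lt_of_succ_lt h⟩)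

/-- A permutation is bigrassmannian if it and its inverse each have exactly one descent. -/
def Bigrassmannian {n : ℕ} (w : Equiv.Perm (Fin n)) : Prop :=
  (descents w).card = 1 ∧ (descents w⁻¹).card = 1

/-- The underlying set of the tetrahedral poset `Tetr_n`:
triples `(i, j, g(i,j,k))` with `1 ≤ i, j ≤ n-1`, `0 ≤ k ≤ d(i,j)`, where
`d(i,j) = min{i, j, n-i, n-j} - 1` and `g(i,j,k) = (n-1)(n-2)/2 - |i-j| - 2k`. -/
def TetrSet (n : ℕ) : Set (ℤ × ℤ × ℤ) :=
  {p | ∃ i j k : ℤ, 1 ≤ i ∧ i ≤ (n : ℤ) - 1 ∧ 1 ≤ j ∧ j ≤ (n : ℤ) - 1 ∧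
    0 ≤ k ∧ k ≤ min (min i j) (min ((n : ℤ) - i) ((n : ℤ) - j)) - 1 ∧
    p = (i, j, ((n : ℤ) - 1) * ((n : ℤ) - 2) / 2 - |i - j| - 2 * k)}

/-- The generating relations of the tetrahedral poset: `(i,j,g) ≤ (i±1, j, g+1)` and
`(i,j,g) ≤ (i, j±1, g+1)`, imposed whenever both triples belong to `Tetr_n`. -/
def tetrStep (n : ℕ) (p q : ℤ × ℤ × ℤ) : Prop :=
  p ∈ TetrSet n ∧ q ∈ TetrSet n ∧ q.2.2 = p.2.2 + 1 ∧
    ((q.2.1 = p.2.1 ∧ (q.1 = p.1 + 1 ∨ q.1 = p.1 - 1)) ∨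
     (q.1 = p.1 ∧ (q.2.1 = p.2.1 + 1 ∨ q.2.1 = p.2.1 - 1)))

/-- The order of the tetrahedral poset: the reflexive-transitive closure of the
generating relations. -/
def tetrLe (n : ℕ) : ℤ × ℤ × ℤ → ℤ × ℤ × ℤ → Prop :=
  Relation.ReflTransGen (tetrStep n)

end ASMPaper

namespace ASMPaper

section Rank

variable {n : ℕ}

/-- The number of positions `p < l` at which `w` takes a value less than `k`. -/
def rk (w : Equiv.Perm (Fin n)) (k l : ℕ) : ℕ :=
  (Finset.univ.filter fun p : Fin n => p.val < l ∧ (w p).val < k).card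

theorem card_filter_position (a b : ℕ) (hb : b ≤ n) :
    (Finset.univ.filter fun p : Fin n => a ≤ p.val ∧ p.val < b).card = b - a := by
  rw [← Nat.card_Ico, ← Finset.card_map Fin.valEmbedding]
  congr 1
  ext x
  simp only [Finset.mem_map, Finset.mem_filter, Finset.mem_univ, true_and,
    Fin.valEmbedding_apply, Finset.mem_Ico]
  constructor
  · rintro ⟨p, hp, rfl⟩
    exact hp
  · intro hx
    exact ⟨⟨x, by omega⟩, hx, rfl⟩

theorem card_filter_value (w : Equiv.Perm (Fin n)) (a b : ℕ) (hb : b ≤ n) :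
    (Finset.univ.filter fun p : Fin n => a ≤ (w p).val ∧ (w p).val < b).card = b - a := by
  rw [← card_filter_position a b hb, ← Finset.card_map w.toEmbedding]
  congr 1
  ext x
  simp only [Finset.mem_map, Finset.mem_filter, Finset.mem_univ, true_and,
    Equiv.coe_toEmbedding]
  constructor
  · rintro ⟨p, hp, rfl⟩
    exact hp
  · intro hx
    exact ⟨w.symm x, by simpa using hx, by simp⟩

theorem csum_permMat_s9 (w : Equiv.Perm (Fin n)) (k l : Fin n) :
    Csum (permMat w) k l = rk w (k + 1) (l + 1) := by
  unfold Csum permMat rk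
  simp only [Matrix.of_apply]
  rw [Finset.sum_comm]
  simp only [Finset.sum_ite_eq, Finset.mem_Iic]
  rw [← Finset.sum_filter, Finset.sum_const, nsmul_eq_mul, mul_one]
  congr 2
  ext p
  simp only [Finset.mem_filter, Finset.mem_Iic, Finset.mem_univ, true_and, Fin.le_def,
    Nat.lt_succ_iff]

theorem rk_le_left (w : Equiv.Perm (Fin n)) (k l : ℕ) (hk : k ≤ n) : rk w k l ≤ k := by
  have h := card_filter_value w 0 k hk
  rw [Nat.sub_zero] at h
  exact (Finset.card_le_card fun p => by simp).trans h.le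

theorem rk_le_right (w : Equiv.Perm (Fin n)) (k l : ℕ) (hl : l ≤ n) : rk w k l ≤ l := by
  have h := card_filter_position (n := n) 0 l hl
  rw [Nat.sub_zero] at h
  exact (Finset.card_le_card fun p => by simp +contextual).trans h.le

theorem rk_le_add (w : Equiv.Perm (Fin n)) (i j k l : ℕ) (hk : k ≤ n) (hl : l ≤ n) :
    rk w k l ≤ rk w i j + (k - i) + (l - j) := by
  rw [← card_filter_value w i k hk, ← card_filter_position (n := n) j l hl]
  refine le_trans (Finset.card_le_card ?_)
    (le_trans (Finset.card_union_le _ _) (Nat.add_le_add_right (Finset.card_union_le _ _) _))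
  intro p
  simp only [Finset.mem_filter, Finset.mem_univ, true_and, Finset.mem_union]
  omega

theorem exists_of_rk_lt_right (w : Equiv.Perm (Fin n)) (k l : ℕ) (hl : l ≤ n)
    (h : rk w k l < l) : ∃ p : Fin n, p.val < l ∧ k ≤ (w p).val := by
  by_contra! hc
  have hcard := card_filter_position (n := n) 0 l hl
  have : l ≤ rk w k l := by
    rw [Nat.sub_zero] at hcard
    refine hcard.ge.trans (Finset.card_le_card fun p => ?_)
    simp only [Finset.mem_filter, Finset.mem_univ, true_and]
    exact fun hp => ⟨hp.2, hc p hp.2⟩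
  omega

theorem exists_of_rk_lt_left (w : Equiv.Perm (Fin n)) (k l : ℕ) (hk : k ≤ n)
    (h : rk w k l < k) : ∃ p : Fin n, (w p).val < k ∧ l ≤ p.val := by
  by_contra! hc
  have hcard := card_filter_value w 0 k hk
  have : k ≤ rk w k l := by
    rw [Nat.sub_zero] at hcard
    refine hcard.ge.trans (Finset.card_le_card fun p => ?_)
    simp only [Finset.mem_filter, Finset.mem_univ, true_and]
    exact fun hp => ⟨hc p hp.2, hp.2⟩
  omega

theorem rk_lt_right (w : Equiv.Perm (Fin n)) (k l : ℕ) (hl : l ≤ n) (p : Fin n)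
    (hp : p.val < l) (hw : k ≤ (w p).val) : rk w k l < l := by
  have hcard := card_filter_position (n := n) 0 l hl
  rw [Nat.sub_zero] at hcard
  refine lt_of_lt_of_eq (Finset.card_lt_card ⟨fun q => by simp +contextual, fun hc => ?_⟩) hcard
  have := hc (x := p) (by simpa using hp)
  simp only [Finset.mem_filter, Finset.mem_univ, true_and] at this
  omega

theorem rk_lt_left (w : Equiv.Perm (Fin n)) (k l : ℕ) (hk : k ≤ n) (p : Fin n)
    (hp : (w p).val < k) (hl : l ≤ p.val) : rk w k l < k := by
  have hcard := card_filter_value w 0 k hk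
  rw [Nat.sub_zero] at hcard
  refine lt_of_lt_of_eq (Finset.card_lt_card ⟨fun q => by simp, fun hc => ?_⟩) hcard
  have := hc (x := p) (by simpa using hp)
  simp only [Finset.mem_filter, Finset.mem_univ, true_and] at this
  omega

theorem eq_of_sum_Iic_eq (F G : Fin n → ℤ)
    (h : ∀ k, ∑ i ∈ Finset.Iic k, F i = ∑ i ∈ Finset.Iic k, G i) : F = G := by
  funext k
  induction k using WellFoundedLT.induction with
  | ind k ih =>
    have hk := h k
    rw [← Finset.Iio_insert, Finset.sum_insert (by simp), Finset.sum_insert (by simp),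
      Finset.sum_congr rfl fun i hi => ih i (Finset.mem_Iio.mp hi)] at hk
    exact add_right_cancel hk

theorem bruhatLe_antisymm {x y : Equiv.Perm (Fin n)} (hxy : bruhatLe x y)
    (hyx : bruhatLe y x) : x = y := by
  have hmat : ∀ j i, permMat x i j = permMat y i j := by
    have hrow : ∀ l : Fin n, (fun i => ∑ j ∈ Finset.Iic l, permMat x i j) =
        fun i => ∑ j ∈ Finset.Iic l, permMat y i j := fun l =>
      eq_of_sum_Iic_eq _ _ fun k => le_antisymm (hyx k l) (hxy k l)
    intro j i
    exact congrFun (eq_of_sum_Iic_eq (permMat x i) (permMat y i) fun l => congrFun (hrow l) i) j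
  ext p
  have := hmat p (x p)
  simp only [permMat, Matrix.of_apply, if_true] at this
  split_ifs at this with h
  · rw [h]
  · simp at this

end Rank

section Descents

variable {n : ℕ}

/-- One plus the position of the descent of a permutation with a unique descent. -/
def descentPos (w : Equiv.Perm (Fin n)) : ℕ := ∑ d ∈ descents w, d + 1

theorem lt_of_forall_not_mem_descents (w : Equiv.Perm (Fin n)) (p : ℕ) (q : ℕ) (hpq : p < q)
    (hq : q < n) (h : ∀ d, p ≤ d → d < q → d ∉ descents w) :
    w ⟨p, hpq.trans hq⟩ < w ⟨q, hq⟩ := by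
  induction q, hpq using Nat.le_induction with
  | base =>
    have := h p le_rfl (Nat.lt_succ_self p)
    simp only [descents, Finset.mem_filter, Finset.mem_range, not_and, not_forall, not_lt] at this
    obtain ⟨h', hle⟩ := this (by omega)
    exact lt_of_le_of_ne hle fun he => by simpa using w.injective he
  | succ q hpq ih =>
    refine (ih (by omega) fun d h1 h2 => h d h1 (by omega)).trans ?_
    have := h q (by omega) (Nat.lt_succ_self q)
    simp only [descents, Finset.mem_filter, Finset.mem_range, not_and, not_forall, not_lt] at this
    obtain ⟨h', hle⟩ := this (by omega)
    exact lt_of_le_of_ne hle fun he => by simpa using w.injective he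

/-- What is used of a permutation with a unique descent, located between the positions
`j - 1` and `j`. -/
structure HasUniqueDescent (w : Equiv.Perm (Fin n)) (j : ℕ) : Prop where
  lt : j < n
  mono : ∀ p q : Fin n, p < q → (q.val < j ∨ j ≤ p.val) → w p < w q
  desc : ∃ p q : Fin n, p.val < j ∧ j ≤ q.val ∧ p < q ∧ w q < w p

theorem hasUniqueDescent (w : Equiv.Perm (Fin n)) (h : (descents w).card = 1) :
    HasUniqueDescent w (descentPos w) := by
  obtain ⟨d, hd⟩ := Finset.card_eq_one.mp h
  have hpos : descentPos w = d + 1 := by simp [descentPos, hd]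
  have hmem : d ∈ descents w := by simp [hd]
  simp only [descents, Finset.mem_filter, Finset.mem_range] at hmem
  rw [hpos]
  refine ⟨by omega, fun p q hpq hj => ?_, ⟨d, by omega⟩, ⟨d + 1, by omega⟩,
    by simp, by simp, by simp [Fin.lt_def], hmem.2 _⟩
  refine lt_of_forall_not_mem_descents w p q hpq q.2 fun e h1 h2 => ?_
  rw [hd, Finset.mem_singleton]
  omega

theorem Bigrassmannian.descent {w : Equiv.Perm (Fin n)} (hw : Bigrassmannian w) :
    HasUniqueDescent w (descentPos w) :=
  hasUniqueDescent w hw.1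

theorem Bigrassmannian.descent_inv {w : Equiv.Perm (Fin n)} (hw : Bigrassmannian w) :
    HasUniqueDescent w⁻¹ (descentPos w⁻¹) :=
  hasUniqueDescent w⁻¹ hw.2

theorem HasUniqueDescent.lt_of_inv {w : Equiv.Perm (Fin n)} {i : ℕ}
    (h : HasUniqueDescent w⁻¹ i) (p q : Fin n) (hpq : w p < w q)
    (hi : (w q).val < i ∨ i ≤ (w p).val) : p < q := by
  simpa using h.mono (w p) (w q) hpq hi

/-- The rank of a bigrassmannian permutation at the corner given by its two descents. -/
def cornerRank (w : Equiv.Perm (Fin n)) : ℕ := rk w (descentPos w⁻¹) (descentPos w)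

theorem Bigrassmannian.rk_eq {w : Equiv.Perm (Fin n)} (hw : Bigrassmannian w) (k l : ℕ)
    (hk : k ≤ n) (hl : l ≤ n) :
    rk w k l =
      min (min k l) (cornerRank w + (k - descentPos w⁻¹) + (l - descentPos w)) := by
  have hup := rk_le_add w (descentPos w⁻¹) (descentPos w) k l hk hl
  have hleft := rk_le_left w k l hk
  have hright := rk_le_right w k l hl
  have hcorner : cornerRank w = rk w (descentPos w⁻¹) (descentPos w) := rfl
  suffices rk w k l < k → rk w k l < l →
      rk w (descentPos w⁻¹) (descentPos w) + (k - descentPos w⁻¹) + (l - descentPos w)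
        ≤ rk w k l by omega
  intro hlk hll
  obtain ⟨p₀, hp₀, hwp₀⟩ := exists_of_rk_lt_right w k l hl hll
  obtain ⟨q₀, hwq₀, hq₀⟩ := exists_of_rk_lt_left w k l hk hlk
  have hmono := hw.descent.mono
  have hinv := hw.descent_inv.lt_of_inv
  generalize descentPos w⁻¹ = i at *
  generalize descentPos w = j at *
  simp only [Fin.lt_def] at hmono hinv
  rw [← card_filter_value w i k hk, ← card_filter_position (n := n) j l hl]
  unfold rk
  rw [← Finset.card_union_of_disjoint, ← Finset.card_union_of_disjoint]
  · refine Finset.card_le_card fun p => ?_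
    simp only [Finset.mem_filter, Finset.mem_univ, true_and, Finset.mem_union]
    have h1 := hmono p₀ p
    have h2 := hinv p p₀
    have h3 := hinv q₀ p
    have h4 := hmono p q₀
    have h5 := hinv q₀ p₀
    have h6 := hmono p₀ q₀
    omega
  · rw [Finset.disjoint_left]
    intro p
    simp only [Finset.mem_filter, Finset.mem_univ, true_and, Finset.mem_union]
    have h2 := hinv p p₀
    have h6 := hmono p₀ q₀
    omega
  · rw [Finset.disjoint_left]
    intro p
    simp only [Finset.mem_filter, Finset.mem_univ, true_and]
    omega

/-- The possible values of the two descent positions and the corner rank. -/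
structure Admissible (n i j r : ℕ) : Prop where
  left_lt : i < n
  right_lt : j < n
  lt_left : r < i
  lt_right : r < j
  add_le : i + j ≤ n + r

theorem Bigrassmannian.admissible {w : Equiv.Perm (Fin n)} (hw : Bigrassmannian w) :
    Admissible n (descentPos w⁻¹) (descentPos w) (cornerRank w) := by
  have hd := hw.descent
  have hi := hw.descent_inv
  have hinv := hw.descent_inv.lt_of_inv
  refine ⟨hi.lt, hd.lt, ?_, ?_, ?_⟩
  · obtain ⟨p, q, hp, hq, hpq, hlt⟩ := hi.desc
    refine rk_lt_left w _ _ hi.lt.le (w⁻¹ p) (by simpa using hp) ?_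
    by_contra! hc
    have := hd.mono _ _ hlt (Or.inl hc)
    have hp : w (w⁻¹ p) = p := w.apply_symm_apply p
    have hq : w (w⁻¹ q) = q := w.apply_symm_apply q
    rw [hp, hq] at this
    omega
  · obtain ⟨p, q, hp, hq, hpq, hlt⟩ := hd.desc
    refine rk_lt_right w _ _ hd.lt.le p hp ?_
    by_contra! hc
    have := hinv _ _ hlt (Or.inl hc)
    omega
  · have := hw.rk_eq n n le_rfl le_rfl
    have hn : rk w n n = n := by simp [rk]
    have := hd.lt
    have := hi.lt
    omega

theorem Bigrassmannian.bruhatLe_iff {x y : Equiv.Perm (Fin n)} (hx : Bigrassmannian x)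
    (hy : Bigrassmannian y) :
    bruhatLe x y ↔ cornerRank y + (descentPos x⁻¹ - descentPos y⁻¹) +
      (descentPos x - descentPos y) ≤ cornerRank x := by
  obtain ⟨h1, h2, h3, h4, h5⟩ := hx.admissible
  constructor
  · intro h
    have h' := h ⟨descentPos x⁻¹ - 1, by omega⟩ ⟨descentPos x - 1, by omega⟩
    rw [csum_permMat_s9, csum_permMat_s9, Nat.cast_le, hy.rk_eq _ _ (by simp; omega) (by simp; omega),
      hx.rk_eq _ _ (by simp; omega) (by simp; omega)] at h'
    simp only at h'
    omega
  · intro h k l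
    rw [csum_permMat_s9, csum_permMat_s9, Nat.cast_le, hy.rk_eq _ _ (by omega) (by omega),
      hx.rk_eq _ _ (by omega) (by omega)]
    omega

end Descents

section BlockSwap

variable {n i j r : ℕ}

/-- Fixes the first `r` positions, and swaps the block of positions from `r` to `j - 1` with
the block of the next `i - r` positions. -/
def blockSwapFun (h : Admissible n i j r) (p : Fin n) : Fin n :=
  ⟨if p.val < r then p else if p.val < j then p + (i - r)
    else if p.val < i + j - r then p - (j - r) else p, by
    obtain ⟨h1, h2, h3, h4, h5⟩ := h
    split_ifs <;> omega⟩

theorem Admissible.symm (h : Admissible n i j r) : Admissible n j i r :=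
  ⟨h.2, h.1, h.4, h.3, by have := h.5; omega⟩

theorem blockSwapFun_blockSwapFun (h : Admissible n i j r) (p : Fin n) :
    blockSwapFun h.symm (blockSwapFun h p) = p := by
  obtain ⟨h1, h2, h3, h4, h5⟩ := id h
  ext
  simp only [blockSwapFun]
  split_ifs <;> omega

/-- The bigrassmannian permutation with prescribed descents and corner rank. -/
def blockSwap (h : Admissible n i j r) : Equiv.Perm (Fin n) where
  toFun := blockSwapFun h
  invFun := blockSwapFun h.symm
  left_inv := blockSwapFun_blockSwapFun h
  right_inv := blockSwapFun_blockSwapFun h.symm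

theorem descents_blockSwap (h : Admissible n i j r) : descents (blockSwap h) = {j - 1} := by
  obtain ⟨h1, h2, h3, h4, h5⟩ := id h
  ext d
  simp only [descents, blockSwap, blockSwapFun, Equiv.coe_fn_mk, Finset.mem_filter,
    Finset.mem_range, Finset.mem_singleton, Fin.mk_lt_mk]
  constructor
  · rintro ⟨hd, hlt⟩
    have := hlt (by omega)
    split_ifs at this <;> omega
  · rintro rfl
    refine ⟨by omega, fun hd => ?_⟩
    split_ifs <;> omega

theorem blockSwap_inv (h : Admissible n i j r) : (blockSwap h)⁻¹ = blockSwap h.symm := rfl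

theorem bigrassmannian_blockSwap (h : Admissible n i j r) : Bigrassmannian (blockSwap h) := by
  refine ⟨?_, ?_⟩
  · rw [descents_blockSwap, Finset.card_singleton]
  · rw [blockSwap_inv, descents_blockSwap, Finset.card_singleton]

theorem descentPos_blockSwap (h : Admissible n i j r) : descentPos (blockSwap h) = j := by
  have := h.lt_right
  rw [descentPos, descents_blockSwap, Finset.sum_singleton]
  omega

theorem cornerRank_blockSwap (h : Admissible n i j r) : cornerRank (blockSwap h) = r := by
  rw [cornerRank, blockSwap_inv, descentPos_blockSwap, descentPos_blockSwap]
  obtain ⟨h1, h2, h3, h4, h5⟩ := id h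
  have hcard := card_filter_position (n := n) 0 r (by omega)
  rw [Nat.sub_zero] at hcard
  refine Eq.trans ?_ hcard
  unfold rk
  congr 1
  ext p
  simp only [Finset.mem_filter, Finset.mem_univ, true_and]
  simp only [blockSwap, blockSwapFun, Equiv.coe_fn_mk]
  split_ifs <;> omega

end BlockSwap

section Tetr

variable {n : ℕ}

/-- The point of the tetrahedral poset with the given descents and corner rank. -/
def tetrPoint (n i j r : ℕ) : ℤ × ℤ × ℤ :=
  (i, (n : ℤ) - j, ((n : ℤ) - 1) * ((n : ℤ) - 2) / 2 + i + j - n - 2 * r)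

theorem tetrPoint_mem {i j r : ℕ} (h : Admissible n i j r) : tetrPoint n i j r ∈ TetrSet n := by
  obtain ⟨h1, h2, h3, h4, h5⟩ := h
  refine ⟨i, (n : ℤ) - j, (r : ℤ) - max 0 ((i : ℤ) + j - n), by omega, by omega, by omega,
    by omega, by omega, by omega, ?_⟩
  simp only [tetrPoint, Prod.mk.injEq, true_and]
  rcases abs_cases ((i : ℤ) - ((n : ℤ) - j)) with h | h <;> omega

theorem exists_tetrPoint {p : ℤ × ℤ × ℤ} (hp : p ∈ TetrSet n) :
    ∃ i j r : ℕ, Admissible n i j r ∧ tetrPoint n i j r = p := by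
  obtain ⟨i, j, k, h1, h2, h3, h4, h5, h6, rfl⟩ := hp
  refine ⟨i.toNat, (n - j).toNat, (k + max 0 (i - j)).toNat,
    ⟨by omega, by omega, by omega, by omega, by omega⟩, ?_⟩
  simp only [tetrPoint, Prod.mk.injEq]
  refine ⟨by omega, by omega, ?_⟩
  rcases abs_cases (i - j) with h | h <;> omega

theorem tetrLe_dist {p q : ℤ × ℤ × ℤ} (h : tetrLe n p q) :
    |q.1 - p.1| + |q.2.1 - p.2.1| ≤ q.2.2 - p.2.2 := by
  induction h with
  | refl => simp
  | @tail b c _ hstep ih =>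
    obtain ⟨-, -, hg, hstep⟩ := hstep
    have h1 : |c.1 - b.1| + |c.2.1 - b.2.1| ≤ 1 := by
      rcases hstep with ⟨h, h' | h'⟩ | ⟨h, h' | h'⟩ <;> simp [h, h']
    have h2 := abs_sub_le c.1 b.1 p.1
    have h3 := abs_sub_le c.2.1 b.2.1 p.2.1
    omega

theorem tetrStep_tetrPoint {i j r i' j' r' : ℕ} (h : Admissible n i j r)
    (h' : Admissible n i' j' r')
    (hs : (j' = j ∧ (i' = i + 1 ∧ r' = r ∨ i = i' + 1 ∧ r = r' + 1)) ∨
      (i' = i ∧ (j' = j + 1 ∧ r' = r ∨ j = j' + 1 ∧ r = r' + 1))) :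
    tetrStep n (tetrPoint n i j r) (tetrPoint n i' j' r') := by
  refine ⟨tetrPoint_mem h, tetrPoint_mem h', ?_, ?_⟩ <;> simp only [tetrPoint] <;> omega

theorem tetrLe_of_le {i' j' r' : ℕ} (h' : Admissible n i' j' r') (m : ℕ) :
    ∀ i j r : ℕ, Admissible n i j r → r' + (i - i') + (j - j') ≤ r →
      i' + j' + 2 * r = i + j + 2 * r' + m →
      tetrLe n (tetrPoint n i j r) (tetrPoint n i' j' r') := by
  induction m with
  | zero =>
    intro i j r _ hle hm
    obtain ⟨rfl, rfl, rfl⟩ : i = i' ∧ j = j' ∧ r = r' := by omega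
    exact Relation.ReflTransGen.refl
  | succ m ih =>
    intro i j r h hle hm
    obtain ⟨h1, h2, h3, h4, h5⟩ := id h
    obtain ⟨h1', h2', h3', h4', h5'⟩ := id h'
    rcases lt_or_ge i' i with hi | hi
    · have hadm : Admissible n (i - 1) j (r - 1) := by constructor <;> omega
      exact .head (tetrStep_tetrPoint h hadm (by omega)) (ih _ _ _ hadm (by omega) (by omega))
    rcases lt_or_ge j' j with hj | hj
    · have hadm : Admissible n i (j - 1) (r - 1) := by constructor <;> omega
      exact .head (tetrStep_tetrPoint h hadm (by omega)) (ih _ _ _ hadm (by omega) (by omega))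
    rcases lt_or_ge j j' with hj' | hj'
    · have hadm : Admissible n i (j + 1) r := by constructor <;> omega
      exact .head (tetrStep_tetrPoint h hadm (by omega)) (ih _ _ _ hadm (by omega) (by omega))
    · have hadm : Admissible n (i + 1) j r := by constructor <;> omega
      exact .head (tetrStep_tetrPoint h hadm (by omega)) (ih _ _ _ hadm (by omega) (by omega))

theorem tetrLe_tetrPoint_iff {i j r i' j' r' : ℕ} (h : Admissible n i j r)
    (h' : Admissible n i' j' r') :
    tetrLe n (tetrPoint n i j r) (tetrPoint n i' j' r') ↔ r' + (i - i') + (j - j') ≤ r := by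
  constructor
  · intro hle
    have hd := tetrLe_dist hle
    simp only [tetrPoint] at hd
    rcases abs_cases ((i' : ℤ) - i) with h1 | h1 <;>
    rcases abs_cases ((n : ℤ) - j' - (n - j)) with h2 | h2 <;> omega
  · intro hle
    exact tetrLe_of_le h' (i' + j' + 2 * r - (i + j + 2 * r')) i j r h hle (by omega)

end Tetr

end ASMPaper

open ASMPaper in
/-- For `n ≥ 2`, the poset of bigrassmannian permutations of `{1, …, n}` under the
Bruhat order is isomorphic to the tetrahedral poset `Tetr_n`. -/
theorem bigrassmannian_iso_tetr (n : ℕ) (hn : 2 ≤ n) :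
    ∃ f : {w : Equiv.Perm (Fin n) // Bigrassmannian w} → {p : ℤ × ℤ × ℤ // p ∈ TetrSet n},
      Function.Bijective f ∧
      ∀ a b : {w : Equiv.Perm (Fin n) // Bigrassmannian w},
        bruhatLe a.1 b.1 ↔ tetrLe n (f a).1 (f b).1 := by
  have hiff : ∀ a b : {w : Equiv.Perm (Fin n) // Bigrassmannian w},
      bruhatLe a.1 b.1 ↔
        tetrLe n (tetrPoint n (descentPos a.1⁻¹) (descentPos a.1) (cornerRank a.1))
          (tetrPoint n (descentPos b.1⁻¹) (descentPos b.1) (cornerRank b.1)) := fun a b => by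
    rw [a.2.bruhatLe_iff b.2, tetrLe_tetrPoint_iff a.2.admissible b.2.admissible]
  refine ⟨fun w => ⟨_, tetrPoint_mem w.2.admissible⟩, ⟨fun a b hab => ?_, fun p => ?_⟩, hiff⟩
  · have hab := Subtype.ext_iff.mp hab
    simp only at hab
    refine Subtype.ext (bruhatLe_antisymm ((hiff a b).mpr ?_) ((hiff b a).mpr ?_)) <;>
      rw [hab] <;> exact Relation.ReflTransGen.refl
  · obtain ⟨i, j, r, h, hp⟩ := exists_tetrPoint p.2
    refine ⟨⟨blockSwap h, bigrassmannian_blockSwap h⟩, Subtype.ext ?_⟩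
    simp only [cornerRank_blockSwap, descentPos_blockSwap, blockSwap_inv]
    exact hp
end
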